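/- arXiv:1410.1461 — 2 statements merged into one kernel-verified Lean document; each statement's English description precedes it below -/
import Mathlib

section
/- Fix integers a and b, and for s ∈ [0,1] define F_s : S¹ × D₂ → S¹ × D₂ by F_s(z,w) = (e^{2πias}·z, e^{2πibs}·w) for |w| ≤ 1 and F_s(z,w) = (e^{2πias(2−|w|)}·z, e^{2πibs(2−|w|)}·w) for 1 ≤ |w| ≤ 2. Then: (i) the map (s,(z,w)) ↦ F_s(z,w) is jointly continuous on [0,1] × (S¹ × D₂); (ii) for each s ∈ [0,1], F_s is a homeomorphism of S¹ × D₂ that fixes every point of S¹ × {w ∈ ℂ : |w| = 2}; (iii) F_0 is the identity; and (iv) F_1 ∘ F_{a,b} is the identity, i.e., F_1 is the inverse of F_{a,b}. -/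
/-!
STATEMENT 5: Fix integers `a` and `b`, and for `s ∈ [0,1]` define
`F_s : S¹ × D₂ → S¹ × D₂` by `F_s(z,w) = (e^{2πias}·z, e^{2πibs}·w)` for `|w| ≤ 1` and
`F_s(z,w) = (e^{2πias(2−|w|)}·z, e^{2πibs(2−|w|)}·w)` for `1 ≤ |w| ≤ 2`. Then:
(i) `(s,(z,w)) ↦ F_s(z,w)` is jointly continuous on `[0,1] × (S¹ × D₂)`;
(ii) for each `s ∈ [0,1]`, `F_s` is a homeomorphism of `S¹ × D₂` fixing every point
of `S¹ × {w : |w| = 2}`;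
(iii) `F_0` is the identity; and
(iv) `F_1 ∘ F_{a,b}` is the identity, i.e. `F_1` is the inverse of `F_{a,b}`.
-/

open unitInterval

/-- The closed disk of radius 2 in `ℂ`. -/
abbrev Disk2 : Type := Metric.closedBall (0 : ℂ) 2

/-- The extension `F_{a,b}` of the Dehn twist over the solid torus `S¹ × D₂`:
`F_{a,b}(z,w) = (z,w)` for `|w| ≤ 1` and
`F_{a,b}(z,w) = (e^{2πia|w|}·z, e^{2πib|w|}·w)` for `1 ≤ |w| ≤ 2`. -/
noncomputable def solidTorusTwist (a b : ℤ) (p : Circle × Disk2) : Circle × Disk2 :=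
  if ‖(p.2 : ℂ)‖ ≤ 1 then p
  else
    (Circle.exp (2 * Real.pi * (a : ℝ) * ‖(p.2 : ℂ)‖) * p.1,
     ⟨(Circle.exp (2 * Real.pi * (b : ℝ) * ‖(p.2 : ℂ)‖) : ℂ) * (p.2 : ℂ), by
        have hw : ‖(p.2 : ℂ)‖ ≤ 2 := by
          simpa [Complex.dist_eq] using Metric.mem_closedBall.mp p.2.2
        rw [Metric.mem_closedBall, Complex.dist_eq, sub_zero, norm_mul, Circle.norm_coe, one_mul]
        exact hw⟩)

/-- The isotopy `F_s`: `F_s(z,w) = (e^{2πias}·z, e^{2πibs}·w)` for `|w| ≤ 1` and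
`F_s(z,w) = (e^{2πias(2−|w|)}·z, e^{2πibs(2−|w|)}·w)` for `1 ≤ |w| ≤ 2`. -/
noncomputable def twistIsotopy (a b : ℤ) (s : I) (p : Circle × Disk2) : Circle × Disk2 :=
  if ‖(p.2 : ℂ)‖ ≤ 1 then
    (Circle.exp (2 * Real.pi * (a : ℝ) * (s : ℝ)) * p.1,
     ⟨(Circle.exp (2 * Real.pi * (b : ℝ) * (s : ℝ)) : ℂ) * (p.2 : ℂ), by
        have hw : ‖(p.2 : ℂ)‖ ≤ 2 := by
          simpa [Complex.dist_eq] using Metric.mem_closedBall.mp p.2.2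
        rw [Metric.mem_closedBall, Complex.dist_eq, sub_zero, norm_mul, Circle.norm_coe, one_mul]
        exact hw⟩)
  else
    (Circle.exp (2 * Real.pi * (a : ℝ) * (s : ℝ) * (2 - ‖(p.2 : ℂ)‖)) * p.1,
     ⟨(Circle.exp (2 * Real.pi * (b : ℝ) * (s : ℝ) * (2 - ‖(p.2 : ℂ)‖)) : ℂ)
        * (p.2 : ℂ), by
        have hw : ‖(p.2 : ℂ)‖ ≤ 2 := by
          simpa [Complex.dist_eq] using Metric.mem_closedBall.mp p.2.2
        rw [Metric.mem_closedBall, Complex.dist_eq, sub_zero, norm_mul, Circle.norm_coe, one_mul]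
        exact hw⟩)

/-- The twist of `S¹ × D₂` by the angles `c * (2 - max 1 |w|)` and `d * (2 - max 1 |w|)`. -/
noncomputable def radialTwist (c d : ℝ) (p : Circle × Disk2) : Circle × Disk2 :=
  (Circle.exp (c * (2 - max 1 ‖(p.2 : ℂ)‖)) * p.1,
   ⟨(Circle.exp (d * (2 - max 1 ‖(p.2 : ℂ)‖)) : ℂ) * (p.2 : ℂ), by
      rw [mem_closedBall_zero_iff, norm_mul, Circle.norm_coe, one_mul]
      exact mem_closedBall_zero_iff.mp p.2.2⟩)

theorem norm_radialTwist_snd (c d : ℝ) (p : Circle × Disk2) :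
    ‖((radialTwist c d p).2 : ℂ)‖ = ‖(p.2 : ℂ)‖ := by
  rw [radialTwist, norm_mul, Circle.norm_coe, one_mul]

theorem radialTwist_zero : radialTwist 0 0 = id := by
  funext p
  simp [radialTwist]

theorem radialTwist_radialTwist (c d c' d' : ℝ) (p : Circle × Disk2) :
    radialTwist c d (radialTwist c' d' p) = radialTwist (c + c') (d + d') p := by
  refine Prod.ext ?_ (Subtype.ext ?_)
  · change Circle.exp (c * (2 - max 1 ‖((radialTwist c' d' p).2 : ℂ)‖)) * _ = _
    rw [norm_radialTwist_snd]
    simp only [radialTwist]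
    rw [← mul_assoc, ← Circle.exp_add, ← add_mul]
  · change (Circle.exp (d * (2 - max 1 ‖((radialTwist c' d' p).2 : ℂ)‖)) : ℂ) * _ = _
    rw [norm_radialTwist_snd]
    simp only [radialTwist]
    rw [← mul_assoc, ← Circle.coe_mul, ← Circle.exp_add, ← add_mul]

theorem continuous_radialTwist :
    Continuous (fun q : (ℝ × ℝ) × (Circle × Disk2) => radialTwist q.1.1 q.1.2 q.2) := by
  unfold radialTwist
  fun_prop

/-- `radialTwist c d` as a homeomorphism, with inverse `radialTwist (-c) (-d)`. -/
noncomputable def radialTwistHomeomorph (c d : ℝ) :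
    (Circle × Disk2) ≃ₜ (Circle × Disk2) where
  toFun := radialTwist c d
  invFun := radialTwist (-c) (-d)
  left_inv p := by simp [radialTwist_radialTwist, radialTwist_zero]
  right_inv p := by simp [radialTwist_radialTwist, radialTwist_zero]
  continuous_toFun := continuous_radialTwist.comp (Continuous.prodMk_right (c, d))
  continuous_invFun := continuous_radialTwist.comp (Continuous.prodMk_right (-c, -d))

theorem radialTwist_of_norm_eq_two (c d : ℝ) {p : Circle × Disk2} (hp : ‖(p.2 : ℂ)‖ = 2) :
    radialTwist c d p = p := by
  simp [radialTwist, hp]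

theorem twistIsotopy_eq_radialTwist (a b : ℤ) (s : I) :
    twistIsotopy a b s = radialTwist (2 * Real.pi * a * s) (2 * Real.pi * b * s) := by
  funext p
  unfold twistIsotopy radialTwist
  split_ifs with h
  · have h₂ : (2 : ℝ) - 1 = 1 := by norm_num
    simp only [max_eq_left h, h₂, mul_one]
  · simp only [max_eq_right (not_le.mp h).le]

theorem solidTorusTwist_eq_radialTwist (a b : ℤ) :
    solidTorusTwist a b = radialTwist (-(2 * Real.pi * a)) (-(2 * Real.pi * b)) := by
  have inner (n : ℤ) : Circle.exp (-(2 * Real.pi * n) * (2 - 1)) = 1 := by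
    rw [← Circle.exp_int_mul_two_pi (-n)]
    congr 1
    push_cast
    ring
  have outer (n : ℤ) (r : ℝ) :
      Circle.exp (-(2 * Real.pi * n) * (2 - r)) = Circle.exp (2 * Real.pi * n * r) := by
    rw [← one_mul (Circle.exp (2 * Real.pi * n * r)), ← Circle.exp_int_mul_two_pi (-2 * n),
      ← Circle.exp_add]
    congr 1
    push_cast
    ring
  funext p
  unfold solidTorusTwist radialTwist
  split_ifs with h
  · simp only [max_eq_left h, inner, one_mul, Circle.coe_one]
  · simp only [max_eq_right (not_le.mp h).le, outer]

theorem twistIsotopy_properties (a b : ℤ) :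
    -- (i) joint continuity
    Continuous (fun q : I × (Circle × Disk2) => twistIsotopy a b q.1 q.2) ∧
    -- (ii) each `F_s` is a homeomorphism fixing the boundary torus pointwise
    (∀ s : I, IsHomeomorph (twistIsotopy a b s) ∧
      ∀ p : Circle × Disk2, ‖(p.2 : ℂ)‖ = 2 → twistIsotopy a b s p = p) ∧
    -- (iii) `F_0 = id`
    twistIsotopy a b 0 = id ∧
    -- (iv) `F_1 ∘ F_{a,b} = id`
    twistIsotopy a b 1 ∘ solidTorusTwist a b = id := by
  refine ⟨?_, fun s => ⟨?_, fun p hp => ?_⟩, ?_, ?_⟩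
  · simp only [twistIsotopy_eq_radialTwist]
    exact continuous_radialTwist.comp
      (f := fun q : I × (Circle × Disk2) =>
        ((2 * Real.pi * a * (q.1 : ℝ), 2 * Real.pi * b * (q.1 : ℝ)), q.2))
      (by fun_prop)
  · rw [twistIsotopy_eq_radialTwist]
    exact (radialTwistHomeomorph _ _).isHomeomorph
  · rw [twistIsotopy_eq_radialTwist, radialTwist_of_norm_eq_two _ _ hp]
  · simp [twistIsotopy_eq_radialTwist, radialTwist_zero]
  · funext p
    simp [twistIsotopy_eq_radialTwist, solidTorusTwist_eq_radialTwist,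
      radialTwist_radialTwist, radialTwist_zero]
end

section
/- For all integers a and b, the homeomorphism F_{a,b} of S¹ × D₂ is isotopic to the identity relative to the boundary: there exists a continuous map H : [0,1] × (S¹ × D₂) → S¹ × D₂ such that H(0,·) is the identity, H(1,·) = F_{a,b}, for every s ∈ [0,1] the map H(s,·) is a homeomorphism of S¹ × D₂, and H(s,(z,w)) = (z,w) for every s ∈ [0,1] whenever |w| = 2. -/
/-!
STATEMENT 6: For all integers `a` and `b`, the homeomorphism `F_{a,b}` of `S¹ × D₂`
is isotopic to the identity relative to the boundary: there exists a continuous map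
`H : [0,1] × (S¹ × D₂) → S¹ × D₂` such that `H(0,·)` is the identity,
`H(1,·) = F_{a,b}`, for every `s ∈ [0,1]` the map `H(s,·)` is a homeomorphism of
`S¹ × D₂`, and `H(s,(z,w)) = (z,w)` for every `s ∈ [0,1]` whenever `|w| = 2`.
-/

open unitInterval

/-- Rotation of the two factors of `S¹ × D₂` by the angles `α` and `β`. -/
noncomputable def solidTorusRotate (α β : ℝ) (p : Circle × Disk2) : Circle × Disk2 :=
  (Circle.exp α * p.1,
   ⟨(Circle.exp β : ℂ) * (p.2 : ℂ), by
      simpa only [mem_closedBall_zero_iff, norm_mul, Circle.norm_coe, one_mul] using p.2.2⟩)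

@[simp]
theorem norm_solidTorusRotate_snd (α β : ℝ) (p : Circle × Disk2) :
    ‖((solidTorusRotate α β p).2 : ℂ)‖ = ‖(p.2 : ℂ)‖ := by
  simp [solidTorusRotate]

theorem solidTorusRotate_eq_of_exp_eq {α β α' β' : ℝ} (hα : Circle.exp α = Circle.exp α')
    (hβ : Circle.exp β = Circle.exp β') (p : Circle × Disk2) :
    solidTorusRotate α β p = solidTorusRotate α' β' p := by
  simp only [solidTorusRotate, hα, hβ]

@[simp]
theorem solidTorusRotate_zero (p : Circle × Disk2) : solidTorusRotate 0 0 p = p := by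
  simp [solidTorusRotate]

theorem solidTorusRotate_solidTorusRotate (α β α' β' : ℝ) (p : Circle × Disk2) :
    solidTorusRotate α β (solidTorusRotate α' β' p) = solidTorusRotate (α + α') (β + β') p := by
  simp [solidTorusRotate, Circle.exp_add, mul_assoc]

theorem continuous_solidTorusRotate {X : Type*} [TopologicalSpace X] {f g : X → ℝ}
    {h : X → Circle × Disk2} (hf : Continuous f) (hg : Continuous g) (hh : Continuous h) :
    Continuous fun x => solidTorusRotate (f x) (g x) (h x) := by
  unfold solidTorusRotate
  fun_prop

/-- Rotating by angles that depend continuously on `|w|` is a homeomorphism. -/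
theorem isHomeomorph_solidTorusRotate_norm {f g : ℝ → ℝ} (hf : Continuous f) (hg : Continuous g) :
    IsHomeomorph fun p : Circle × Disk2 =>
      solidTorusRotate (f ‖(p.2 : ℂ)‖) (g ‖(p.2 : ℂ)‖) p := by
  refine isHomeomorph_iff_exists_inverse.2
    ⟨continuous_solidTorusRotate (by fun_prop) (by fun_prop) continuous_id,
      fun p => solidTorusRotate (-f ‖(p.2 : ℂ)‖) (-g ‖(p.2 : ℂ)‖) p, fun p => ?_, fun p => ?_,
      continuous_solidTorusRotate (by fun_prop) (by fun_prop) continuous_id⟩ <;>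
    simp [solidTorusRotate_solidTorusRotate]

theorem Circle.exp_int_mul_two_pi_mul_sub_two (n : ℤ) (r : ℝ) :
    Circle.exp (n * (2 * Real.pi * (r - 2))) = Circle.exp (2 * Real.pi * n * r) :=
  Circle.exp_eq_exp.2 ⟨-2 * n, by push_cast; ring⟩

theorem solidTorusTwist_eq_solidTorusRotate (a b : ℤ) (p : Circle × Disk2) :
    solidTorusTwist a b p =
      solidTorusRotate (a * (2 * Real.pi * (max ‖(p.2 : ℂ)‖ 1 - 2)))
        (b * (2 * Real.pi * (max ‖(p.2 : ℂ)‖ 1 - 2))) p := by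
  rw [solidTorusRotate_eq_of_exp_eq (Circle.exp_int_mul_two_pi_mul_sub_two a _)
    (Circle.exp_int_mul_two_pi_mul_sub_two b _)]
  unfold solidTorusTwist
  split_ifs with h
  · have exp_eq_one (n : ℤ) : Circle.exp (2 * Real.pi * n * 1) = Circle.exp 0 :=
      Circle.exp_eq_exp.2 ⟨n, by ring⟩
    rw [max_eq_right h, solidTorusRotate_eq_of_exp_eq (exp_eq_one a) (exp_eq_one b),
      solidTorusRotate_zero]
  · rw [max_eq_left (not_le.1 h).le]
    rfl

theorem solidTorusTwist_isotopic_id_rel_boundary (a b : ℤ) :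
    ∃ H : I × (Circle × Disk2) → Circle × Disk2,
      Continuous H ∧
      (∀ p : Circle × Disk2, H (0, p) = p) ∧
      (∀ p : Circle × Disk2, H (1, p) = solidTorusTwist a b p) ∧
      (∀ s : I, IsHomeomorph (fun p => H (s, p))) ∧
      (∀ (s : I) (p : Circle × Disk2), ‖(p.2 : ℂ)‖ = 2 → H (s, p) = p) := by
  let θ (s r : ℝ) : ℝ := s * (2 * Real.pi * (max r 1 - 2))
  refine ⟨fun q => solidTorusRotate (a * θ q.1 ‖(q.2.2 : ℂ)‖) (b * θ q.1 ‖(q.2.2 : ℂ)‖) q.2,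
    continuous_solidTorusRotate (by fun_prop) (by fun_prop) continuous_snd,
    fun p => by simp [θ], fun p => by simp [θ, solidTorusTwist_eq_solidTorusRotate],
    fun s => isHomeomorph_solidTorusRotate_norm (f := fun r => a * θ s r) (g := fun r => b * θ s r)
      (by fun_prop) (by fun_prop),
    fun s p hp => by simp [θ, hp]⟩
end
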